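/- Let s > 3/2 and λ ∈ (4/3, 3/2). There exists a constant C̃₂ > 0 such that liminf_{n→∞} ‖f_n ∂_x Λ u_{0,n}‖_{H^{s-1}} ≥ C̃₂, where u_{0,n}(x) = 2^{-ns} φ(x) sin(λ2^n x), f_n(x) = 2^{-n} φ(x), and Λ is the Fourier multiplier with symbol (1+ξ²)^{1/2}. -/

import Mathlib

open MeasureTheory Filter Complex

noncomputable section

/-- Fourier transform with convention `f̂(ξ) = ∫ e^{-ixξ} f(x) dx`. -/
def FT (f : ℝ → ℂ) (ξ : ℝ) : ℂ :=
  ∫ x : ℝ, Complex.exp (-(Complex.I * (x : ℂ) * (ξ : ℂ))) * f x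

/-- Sobolev `H^σ` norm: `‖f‖_{H^σ}² = ∫ (1+ξ²)^σ |f̂(ξ)|² dξ`. -/
def HNorm (σ : ℝ) (f : ℝ → ℂ) : ℝ :=
  Real.sqrt (∫ ξ : ℝ, (1 + ξ ^ 2) ^ σ * ‖FT f ξ‖ ^ 2)

/-- Membership in `H^σ` (finiteness of the `H^σ` norm). -/
def MemHs (σ : ℝ) (f : ℝ → ℂ) : Prop :=
  MeasureTheory.Integrable (fun ξ : ℝ => (1 + ξ ^ 2) ^ σ * ‖FT f ξ‖ ^ 2)

/-- `L²` norm. -/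
def L2Norm (f : ℝ → ℂ) : ℝ :=
  Real.sqrt (∫ x : ℝ, ‖f x‖ ^ 2)

/-- Fourier multiplier operator with symbol `m`. -/
def FMul (m : ℝ → ℂ) (f : ℝ → ℂ) (x : ℝ) : ℂ :=
  (1 / (2 * (Real.pi : ℂ))) * ∫ ξ : ℝ, Complex.exp (Complex.I * (x : ℂ) * (ξ : ℂ)) * m ξ * FT f ξ

/-- `Λ = (1-∂ₓ²)^{1/2}`: Fourier multiplier with symbol `(1+ξ²)^{1/2}`. -/
def Lam (f : ℝ → ℂ) : ℝ → ℂ :=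
  FMul (fun ξ => ((Real.sqrt (1 + ξ ^ 2) : ℝ) : ℂ)) f

/-- `e^{-t ∂ₓ Λ^{-1}}`: Fourier multiplier with symbol `e^{-itξ(1+ξ²)^{-1/2}}`. -/
def ExpOp (t : ℝ) (f : ℝ → ℂ) : ℝ → ℂ :=
  FMul (fun ξ => Complex.exp (-(Complex.I * (t : ℂ) * (ξ : ℂ) / ((Real.sqrt (1 + ξ ^ 2) : ℝ) : ℂ)))) f

/-- Hypotheses on the fixed Schwartz function `φ`: its Fourier transform is a smooth, even,
real-valued function with values in `[0,1]`, equal to `1` on `[-1/4,1/4]` and to `0`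
outside `(-1/2,1/2)`. -/
def PhiHyp (φ : ℝ → ℂ) : Prop :=
  ∃ ψ : ℝ → ℝ, (∀ ξ : ℝ, FT φ ξ = (ψ ξ : ℂ)) ∧ ContDiff ℝ (⊤ : ℕ∞) ψ ∧
    (∀ ξ : ℝ, ψ (-ξ) = ψ ξ) ∧ (∀ ξ : ℝ, ψ ξ ∈ Set.Icc (0 : ℝ) 1) ∧
    (∀ ξ : ℝ, |ξ| ≤ 1 / 4 → ψ ξ = 1) ∧ (∀ ξ : ℝ, 1 / 2 ≤ |ξ| → ψ ξ = 0)

/-- The high-frequency data `u_{0,n}(x) = 2^{-ns} φ(x) sin(λ 2ⁿ x)`. -/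
def u0n (s lam : ℝ) (φ : ℝ → ℂ) (n : ℕ) : ℝ → ℂ :=
  fun x => (((2 : ℝ) ^ (-((n : ℝ) * s)) : ℝ) : ℂ) * φ x * ((Real.sin (lam * 2 ^ n * x) : ℝ) : ℂ)

/-- The low-frequency data `f_n(x) = 2^{-n} φ(x)`. -/
def fseq (φ : ℝ → ℂ) (n : ℕ) : ℝ → ℂ :=
  fun x => (((2 : ℝ) ^ (-(n : ℝ)) : ℝ) : ℂ) * φ x

/-- The kernel `K(x) = -(1/2) sgn(x) e^{-|x|}`, so that `K*f = ∂ₓ(1-∂ₓ²)^{-1} f`. -/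
def Kker (x : ℝ) : ℝ := -(1 / 2) * Real.sign x * Real.exp (-|x|)

/-- Convolution with the kernel `K`. -/
def Kconv (f : ℝ → ℂ) (x : ℝ) : ℂ := ∫ y : ℝ, ((Kker (x - y) : ℝ) : ℂ) * f y

/-- `(u,ϱ)` solves the two-component Camassa–Holm system (in nonlocal form) on `[0,T]`. -/
def Is2CHSolution (T : ℝ) (u ϱ : ℝ → ℝ → ℂ) : Prop :=
  ∀ t ∈ Set.Icc (0 : ℝ) T, ∀ x : ℝ,
    (deriv (fun τ => u τ x) t + Kconv (ϱ t) x + u t x * deriv (u t) x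
      = - Kconv (fun y => (u t y) ^ 2 + (1 / 2 : ℂ) * (deriv (u t) y) ^ 2
          + (1 / 2 : ℂ) * (ϱ t y) ^ 2) x)
    ∧ (deriv (fun τ => ϱ τ x) t + deriv (u t) x + u t x * deriv (ϱ t) x
        + ϱ t x * deriv (u t) x = 0)

/-- `u ∈ C([0,T]; H^γ)`: each time slice is in `H^γ` and `t ↦ u(t)` is continuous
in the `H^γ` norm. -/
def ContInHs (T γ : ℝ) (u : ℝ → ℝ → ℂ) : Prop :=
  (∀ t ∈ Set.Icc (0 : ℝ) T, MemHs γ (u t)) ∧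
  ∀ t₀ ∈ Set.Icc (0 : ℝ) T,
    Filter.Tendsto (fun t => HNorm γ (fun x => u t x - u t₀ x))
      (nhdsWithin t₀ (Set.Icc (0 : ℝ) T)) (nhds 0)

end

/-- Differentiation under the integral sign for an inverse Fourier integral. -/
lemma hasDerivAt_integral_exp_mul (g : ℝ → ℂ) (hg : Integrable g)
    (hg' : Integrable fun η : ℝ => (η : ℂ) * g η) (x : ℝ) :
    HasDerivAt (fun x : ℝ => ∫ η : ℝ, Complex.exp (Complex.I * (x : ℂ) * (η : ℂ)) * g η)
      (∫ η : ℝ, Complex.exp (Complex.I * (x : ℂ) * (η : ℂ)) * (Complex.I * ((η : ℂ) * g η))) x := by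
  have hexp : ∀ x η : ℝ, ‖Complex.exp (Complex.I * (x : ℂ) * (η : ℂ))‖ = 1 := by
    intro x η
    rw [show Complex.I * (x : ℂ) * (η : ℂ) = ((x * η : ℝ) : ℂ) * Complex.I by push_cast; ring]
    exact Complex.norm_exp_ofReal_mul_I _
  have hmeas : ∀ x : ℝ, AEStronglyMeasurable
      (fun η : ℝ => Complex.exp (Complex.I * (x : ℂ) * (η : ℂ))) volume := fun x =>
    (by fun_prop : Continuous fun η : ℝ =>
      Complex.exp (Complex.I * (x : ℂ) * (η : ℂ))).aestronglyMeasurable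
  refine (hasDerivAt_integral_of_dominated_loc_of_deriv_le
    (F := fun (x : ℝ) (η : ℝ) => Complex.exp (Complex.I * (x : ℂ) * (η : ℂ)) * g η)
    (F' := fun (x : ℝ) (η : ℝ) =>
      Complex.exp (Complex.I * (x : ℂ) * (η : ℂ)) * (Complex.I * ((η : ℂ) * g η)))
    (bound := fun η : ℝ => ‖(η : ℂ) * g η‖) (s := Set.univ) Filter.univ_mem ?_ ?_ ?_ ?_ ?_ ?_).2
  · exact Eventually.of_forall fun x => (hmeas x).mul hg.aestronglyMeasurable
  · exact hg.bdd_mul (hmeas x) (Eventually.of_forall fun η => (hexp x η).le)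
  · exact (hmeas x).mul (hg'.aestronglyMeasurable.const_mul _)
  · refine Eventually.of_forall fun η x _ => ?_
    rw [norm_mul, hexp, one_mul, norm_mul, Complex.norm_I, one_mul]
  · exact hg'.norm
  · refine Eventually.of_forall fun η x _ => ?_
    have h1 : HasDerivAt (fun x : ℝ => Complex.I * (x : ℂ) * (η : ℂ)) (Complex.I * 1 * (η : ℂ)) x :=
      ((Complex.ofRealCLM.hasDerivAt (x := x)).const_mul Complex.I).mul_const _
    refine ((h1.cexp).mul_const (g η)).congr_deriv ?_
    ring

/-- The Fourier transform of a product of `φ` with an inverse Fourier integral is a convolution. -/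
lemma FT_mul_integral_exp (φ g : ℝ → ℂ) (hφ : Integrable φ) (hg : Integrable g) (ξ : ℝ) :
    FT (fun x => φ x * ∫ η : ℝ, Complex.exp (Complex.I * (x : ℂ) * (η : ℂ)) * g η) ξ
      = ∫ η : ℝ, g η * FT φ (ξ - η) := by
  have hint : Integrable (Function.uncurry fun x η : ℝ =>
      Complex.exp (((x * (η - ξ) : ℝ) : ℂ) * Complex.I) * (φ x * g η)) (volume.prod volume) := by
    refine (hφ.mul_prod hg).bdd_mul (c := 1) (f := fun p : ℝ × ℝ =>
      Complex.exp (((p.1 * (p.2 - ξ) : ℝ) : ℂ) * Complex.I)) ?_ ?_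
    · exact Continuous.aestronglyMeasurable (by fun_prop)
    · exact Eventually.of_forall fun p => (Complex.norm_exp_ofReal_mul_I _).le
  unfold FT
  calc _ = ∫ x : ℝ, ∫ η : ℝ,
        Complex.exp (((x * (η - ξ) : ℝ) : ℂ) * Complex.I) * (φ x * g η) := by
        refine integral_congr_ae (Eventually.of_forall fun x => ?_)
        simp only
        rw [← mul_assoc, ← integral_const_mul]
        refine integral_congr_ae (Eventually.of_forall fun η => ?_)
        simp only
        rw [show ((x * (η - ξ) : ℝ) : ℂ) * Complex.I
          = -(Complex.I * (x : ℂ) * (ξ : ℂ)) + Complex.I * (x : ℂ) * (η : ℂ) by push_cast; ring,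
          Complex.exp_add]
        ring
    _ = ∫ η : ℝ, ∫ x : ℝ,
        Complex.exp (((x * (η - ξ) : ℝ) : ℂ) * Complex.I) * (φ x * g η) :=
        integral_integral_swap hint
    _ = _ := by
        refine integral_congr_ae (Eventually.of_forall fun η => ?_)
        simp only
        rw [← integral_const_mul]
        refine integral_congr_ae (Eventually.of_forall fun x => ?_)
        simp only
        rw [show ((x * (η - ξ) : ℝ) : ℂ) * Complex.I
          = -(Complex.I * (x : ℂ) * ((ξ - η : ℝ) : ℂ)) by push_cast; ring]
        ring

lemma FT_const_mul (c : ℂ) (f : ℝ → ℂ) (ξ : ℝ) : FT (fun x => c * f x) ξ = c * FT f ξ := by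
  unfold FT
  rw [← integral_const_mul]
  congr 1
  ext x
  ring

/-- Multiplication by `sin (a x)` splits the Fourier transform into two shifted copies. -/
lemma FT_mul_sin (φ : ℝ → ℂ) (hφ : Integrable φ) (a ξ : ℝ) :
    FT (fun x => φ x * ((Real.sin (a * x) : ℝ) : ℂ)) ξ
      = (1 / (2 * Complex.I)) * (FT φ (ξ - a) - FT φ (ξ + a)) := by
  have hint : ∀ ζ : ℝ, Integrable fun x : ℝ =>
      Complex.exp (-(Complex.I * (x : ℂ) * (ζ : ℂ))) * φ x := by
    intro ζ
    refine hφ.bdd_mul (c := 1) (Continuous.aestronglyMeasurable (by fun_prop)) ?_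
    refine Eventually.of_forall fun x => ?_
    rw [show -(Complex.I * (x : ℂ) * (ζ : ℂ)) = ((-(x * ζ) : ℝ) : ℂ) * Complex.I by push_cast; ring]
    exact (Complex.norm_exp_ofReal_mul_I _).le
  unfold FT
  rw [← integral_sub (hint _) (hint _), ← integral_const_mul]
  refine integral_congr_ae (Eventually.of_forall fun x => ?_)
  simp only
  rw [Complex.ofReal_sin, Complex.sin]
  rw [show -(Complex.I * (x : ℂ) * ((ξ - a : ℝ) : ℂ))
      = -(Complex.I * (x : ℂ) * (ξ : ℂ)) + ((a * x : ℝ) : ℂ) * Complex.I by push_cast; ring,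
    show -(Complex.I * (x : ℂ) * ((ξ + a : ℝ) : ℂ))
      = -(Complex.I * (x : ℂ) * (ξ : ℂ)) + -((a * x : ℝ) : ℂ) * Complex.I by push_cast; ring,
    Complex.exp_add, Complex.exp_add]
  have hI : 1 / (2 * Complex.I) = -(Complex.I / 2) := by
    rw [one_div, mul_inv, Complex.inv_I]; ring
  rw [hI]
  ring

/-- The integrand of the convolution giving the Fourier transform of `φ ∂ₓΛ(φ sin(a ·))`,
up to a constant factor. -/
noncomputable def convIntegrand (ψ : ℝ → ℝ) (a ξ η : ℝ) : ℝ :=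
  η * Real.sqrt (1 + η ^ 2) * (ψ (η - a) - ψ (η + a)) * ψ (ξ - η)

lemma FT_fseq_mul_deriv_Lam (s lam : ℝ) (φ : ℝ → ℂ) (hφi : Integrable φ) (ψ : ℝ → ℝ)
    (hFT : ∀ ξ, FT φ ξ = (ψ ξ : ℂ)) (hψc : Continuous ψ)
    (hψ0 : ∀ ξ : ℝ, 1 / 2 ≤ |ξ| → ψ ξ = 0) (n : ℕ) (ξ : ℝ) :
    FT (fun x => fseq φ n x * deriv (Lam (u0n s lam φ n)) x) ξ
      = (((2 : ℝ) ^ (-(n : ℝ)) * (2 : ℝ) ^ (-((n : ℝ) * s)) / (4 * Real.pi)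
          * ∫ η, convIntegrand ψ (lam * 2 ^ n) ξ η : ℝ) : ℂ) := by
  set a : ℝ := lam * 2 ^ n with ha
  set c : ℝ := (2 : ℝ) ^ (-((n : ℝ) * s)) with hc
  set d : ℝ := (2 : ℝ) ^ (-(n : ℝ)) with hd
  have hsupp : HasCompactSupport ψ := by
    refine HasCompactSupport.intro (isCompact_Icc (a := (-1 / 2 : ℝ)) (b := 1 / 2)) fun x hx => ?_
    refine hψ0 x ?_
    by_contra! h
    rw [abs_lt] at h
    exact hx ⟨by linarith, by linarith⟩
  let p : ℝ → ℝ := fun η => Real.sqrt (1 + η ^ 2) * (ψ (η - a) - ψ (η + a))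
  have hpc : Continuous p := by fun_prop
  have hps : HasCompactSupport p := by
    refine HasCompactSupport.mul_left ?_
    exact (hsupp.comp_homeomorph (Homeomorph.subRight a)).sub
      (hsupp.comp_homeomorph (Homeomorph.addRight a))
  let g : ℝ → ℂ := fun η => ((Real.sqrt (1 + η ^ 2) : ℝ) : ℂ) * FT (u0n s lam φ n) η
  have hu : ∀ η, FT (u0n s lam φ n) η
      = (c : ℂ) * ((1 / (2 * Complex.I)) * ((ψ (η - a) : ℂ) - (ψ (η + a) : ℂ))) := by
    intro η
    rw [← hFT, ← hFT, ← FT_mul_sin φ hφi, ← FT_const_mul]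
    unfold u0n
    simp only [mul_assoc, ha, hc]
  have hgp : g = fun η => ((c : ℂ) * (1 / (2 * Complex.I))) * ((p η : ℝ) : ℂ) := by
    funext η
    simp only [g, hu, p]
    push_cast
    ring
  have hpi : Integrable fun η => ((p η : ℝ) : ℂ) := (hpc.integrable_of_hasCompactSupport hps).ofReal
  have hpi' : Integrable fun η : ℝ => ((η * p η : ℝ) : ℂ) :=
    ((by fun_prop : Continuous fun η : ℝ => η * p η).integrable_of_hasCompactSupport
      hps.mul_left).ofReal
  have hg : Integrable g := by rw [hgp]; exact hpi.const_mul _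
  have hg' : Integrable fun η : ℝ => (η : ℂ) * g η := by
    convert hpi'.const_mul ((c : ℂ) * (1 / (2 * Complex.I))) using 2 with η
    rw [hgp]
    push_cast
    ring
  have hLam : Lam (u0n s lam φ n) = fun x : ℝ => (1 / (2 * (Real.pi : ℂ))) *
      ∫ η : ℝ, Complex.exp (Complex.I * (x : ℂ) * (η : ℂ)) * g η := by
    funext x
    simp only [Lam, FMul, g, mul_assoc]
  have hder : ∀ x, deriv (Lam (u0n s lam φ n)) x = (1 / (2 * (Real.pi : ℂ))) *
      ∫ η : ℝ, Complex.exp (Complex.I * (x : ℂ) * (η : ℂ)) * (Complex.I * ((η : ℂ) * g η)) := by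
    intro x
    rw [hLam]
    exact ((hasDerivAt_integral_exp_mul g hg hg' x).const_mul _).deriv
  have hfun : (fun x => fseq φ n x * deriv (Lam (u0n s lam φ n)) x) = fun x =>
      ((d : ℂ) * (1 / (2 * (Real.pi : ℂ)))) * (φ x *
      ∫ η : ℝ, Complex.exp (Complex.I * (x : ℂ) * (η : ℂ)) * (Complex.I * ((η : ℂ) * g η))) := by
    funext x
    rw [hder, fseq]
    ring
  rw [hfun, FT_const_mul, FT_mul_integral_exp φ _ hφi (hg'.const_mul _), Complex.ofReal_mul,
    ← integral_complex_ofReal, ← integral_const_mul, ← integral_const_mul]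
  refine integral_congr_ae (Eventually.of_forall fun η => ?_)
  simp only [hFT, hgp, convIntegrand, p]
  push_cast
  field_simp
  ring


lemma continuous_convIntegrand {ψ : ℝ → ℝ} (hψc : Continuous ψ) (a : ℝ) :
    Continuous (Function.uncurry (convIntegrand ψ a)) := by
  unfold Function.uncurry convIntegrand
  fun_prop

lemma convIntegrand_nonneg {ψ : ℝ → ℝ} (hψ01 : ∀ ξ : ℝ, ψ ξ ∈ Set.Icc (0 : ℝ) 1)
    (hψ0 : ∀ ξ : ℝ, 1 / 2 ≤ |ξ| → ψ ξ = 0) {a : ℝ} (ha : 1 / 2 ≤ a) (ξ η : ℝ) :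
    0 ≤ convIntegrand ψ a ξ η := by
  refine mul_nonneg ?_ (hψ01 _).1
  have h1 := Real.sqrt_nonneg (1 + η ^ 2)
  rcases le_total 0 η with h | h
  · rw [hψ0 (η + a) (by rw [abs_of_nonneg] <;> linarith), sub_zero]
    exact mul_nonneg (mul_nonneg h h1) (hψ01 _).1
  · rw [hψ0 (η - a) (by rw [abs_of_nonpos] <;> linarith), zero_sub]
    have := mul_nonneg (mul_nonneg (neg_nonneg.2 h) h1) (hψ01 (η + a)).1
    linarith

lemma convIntegrand_eq_zero {ψ : ℝ → ℝ} (hψ0 : ∀ ξ : ℝ, 1 / 2 ≤ |ξ| → ψ ξ = 0) {a ξ : ℝ}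
    (h1 : 1 ≤ |ξ - a|) (h2 : 1 ≤ |ξ + a|) (η : ℝ) : convIntegrand ψ a ξ η = 0 := by
  unfold convIntegrand
  by_cases h : 1 / 2 ≤ |ξ - η|
  · rw [hψ0 _ h, mul_zero]
  · have e1 : |ξ - a| ≤ |ξ - η| + |η - a| := abs_sub_le _ _ _
    have e2 : |ξ + a| ≤ |ξ - η| + |η + a| := by
      simpa using abs_sub_le ξ η (-a)
    rw [hψ0 (η - a) (by linarith), hψ0 (η + a) (by linarith)]
    simp

lemma convIntegrand_le {ψ : ℝ → ℝ} (hψ01 : ∀ ξ : ℝ, ψ ξ ∈ Set.Icc (0 : ℝ) 1)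
    (hψ0 : ∀ ξ : ℝ, 1 / 2 ≤ |ξ| → ψ ξ = 0) {N a : ℝ} (hN : 2 ≤ N) (ha0 : 0 ≤ a)
    (ha : a < 3 / 2 * N) (ξ η : ℝ) :
    convIntegrand ψ a ξ η ≤ (Set.Icc (a - 1 / 2) (a + 1 / 2) ∪
      Set.Icc (-a - 1 / 2) (-a + 1 / 2)).indicator (fun _ => 5 * N ^ 2) η := by
  by_cases h : η ∈ Set.Icc (a - 1 / 2) (a + 1 / 2) ∪ Set.Icc (-a - 1 / 2) (-a + 1 / 2)
  · rw [Set.indicator_of_mem h]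
    have hη : |η| ≤ 2 * N := by
      rw [abs_le]
      rcases h with ⟨h1, h2⟩ | ⟨h1, h2⟩ <;> constructor <;> linarith
    have hη2 : η ^ 2 ≤ (2 * N) ^ 2 := sq_le_sq' (abs_le.1 hη).1 (abs_le.1 hη).2
    have hs : |η * Real.sqrt (1 + η ^ 2)| ≤ 5 * N ^ 2 := by
      refine abs_le_of_sq_le_sq ?_ (by positivity)
      rw [mul_pow, Real.sq_sqrt (by positivity), sq (5 * N ^ 2)]
      gcongr <;> nlinarith
    have hd : |ψ (η - a) - ψ (η + a)| ≤ 1 := by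
      have := hψ01 (η - a)
      have := hψ01 (η + a)
      simp only [Set.mem_Icc] at *
      rw [abs_le]
      constructor <;> linarith
    have hp : |ψ (ξ - η)| ≤ 1 := by
      rw [abs_of_nonneg (hψ01 _).1]
      exact (hψ01 _).2
    refine (le_abs_self _).trans ?_
    unfold convIntegrand
    rw [abs_mul, abs_mul]
    calc _ ≤ 5 * N ^ 2 * 1 * 1 := by gcongr
      _ = _ := by ring
  · rw [Set.indicator_of_notMem h]
    simp only [Set.mem_union, Set.mem_Icc, not_or] at h
    have h1 : 1 / 2 ≤ |η - a| := by
      by_contra! h'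
      rw [abs_lt] at h'
      exact h.1 ⟨by linarith, by linarith⟩
    have h2 : 1 / 2 ≤ |η + a| := by
      by_contra! h'
      rw [abs_lt] at h'
      exact h.2 ⟨by linarith, by linarith⟩
    simp [convIntegrand, hψ0 _ h1, hψ0 _ h2]

lemma le_convIntegrand {ψ : ℝ → ℝ} (hψ1 : ∀ ξ : ℝ, |ξ| ≤ 1 / 4 → ψ ξ = 1)
    (hψ0 : ∀ ξ : ℝ, 1 / 2 ≤ |ξ| → ψ ξ = 0) {N a : ℝ} (hN : 2 ≤ N) (ha : 4 / 3 * N < a)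
    {ξ η : ℝ} (hξ : ξ ∈ Set.Icc (a - 1 / 8) (a + 1 / 8))
    (hη : η ∈ Set.Icc (a - 1 / 8) (a + 1 / 8)) : N ^ 2 ≤ convIntegrand ψ a ξ η := by
  obtain ⟨h1, h2⟩ := hξ
  obtain ⟨h3, h4⟩ := hη
  unfold convIntegrand
  rw [hψ1 (η - a) (by rw [abs_le]; constructor <;> linarith),
    hψ1 (ξ - η) (by rw [abs_le]; constructor <;> linarith),
    hψ0 (η + a) (by rw [abs_of_nonneg] <;> linarith)]
  have h5 : N ≤ η := by linarith
  have h6 : N ≤ Real.sqrt (1 + η ^ 2) := Real.le_sqrt_of_sq_le (by nlinarith)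
  nlinarith

lemma measure_Icc_union_ne_top (a b c d : ℝ) :
    volume (Set.Icc a b ∪ Set.Icc c d) ≠ ⊤ :=
  (isCompact_Icc.union isCompact_Icc).measure_ne_top

lemma integrable_convIntegrand {ψ : ℝ → ℝ} (hψc : Continuous ψ)
    (hψ01 : ∀ ξ : ℝ, ψ ξ ∈ Set.Icc (0 : ℝ) 1)
    (hψ0 : ∀ ξ : ℝ, 1 / 2 ≤ |ξ| → ψ ξ = 0) {N a : ℝ} (hN : 2 ≤ N) (ha1 : 4 / 3 * N < a)
    (ha2 : a < 3 / 2 * N) (ξ : ℝ) : Integrable (convIntegrand ψ a ξ) := by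
  refine Integrable.mono' (g := (Set.Icc (a - 1 / 2) (a + 1 / 2) ∪
      Set.Icc (-a - 1 / 2) (-a + 1 / 2)).indicator (fun _ => 5 * N ^ 2)) ?_ ?_ ?_
  · rw [integrable_indicator_iff (measurableSet_Icc.union measurableSet_Icc)]
    exact integrableOn_const (measure_Icc_union_ne_top _ _ _ _)
  · exact ((continuous_convIntegrand hψc a).comp (by fun_prop :
      Continuous fun η : ℝ => (ξ, η))).aestronglyMeasurable
  · refine Eventually.of_forall fun η => ?_
    rw [Real.norm_of_nonneg (convIntegrand_nonneg hψ01 hψ0 (by linarith) ξ η)]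
    exact convIntegrand_le hψ01 hψ0 hN (by linarith) ha2 ξ η

lemma integral_convIntegrand_le {ψ : ℝ → ℝ} (hψc : Continuous ψ)
    (hψ01 : ∀ ξ : ℝ, ψ ξ ∈ Set.Icc (0 : ℝ) 1)
    (hψ0 : ∀ ξ : ℝ, 1 / 2 ≤ |ξ| → ψ ξ = 0) {N a : ℝ} (hN : 2 ≤ N) (ha1 : 4 / 3 * N < a)
    (ha2 : a < 3 / 2 * N) (ξ : ℝ) : ∫ η, convIntegrand ψ a ξ η ≤ 10 * N ^ 2 := by
  have hms : MeasurableSet (Set.Icc (a - 1 / 2) (a + 1 / 2) ∪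
      Set.Icc (-a - 1 / 2) (-a + 1 / 2)) := measurableSet_Icc.union measurableSet_Icc
  have hv : volume.real (Set.Icc (a - 1 / 2) (a + 1 / 2) ∪
      Set.Icc (-a - 1 / 2) (-a + 1 / 2)) ≤ 2 := by
    refine (measureReal_union_le _ _).trans ?_
    rw [Real.volume_real_Icc_of_le (by linarith), Real.volume_real_Icc_of_le (by linarith)]
    linarith
  calc _ ≤ ∫ η, (Set.Icc (a - 1 / 2) (a + 1 / 2) ∪
      Set.Icc (-a - 1 / 2) (-a + 1 / 2)).indicator (fun _ => 5 * N ^ 2) η := by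
        refine integral_mono (integrable_convIntegrand hψc hψ01 hψ0 hN ha1 ha2 ξ) ?_
          fun η => convIntegrand_le hψ01 hψ0 hN (by linarith) ha2 ξ η
        rw [integrable_indicator_iff hms]
        exact integrableOn_const (measure_Icc_union_ne_top _ _ _ _)
    _ ≤ 2 * (5 * N ^ 2) := by
        rw [integral_indicator_const _ hms, smul_eq_mul]
        gcongr
    _ = _ := by ring

lemma le_integral_convIntegrand {ψ : ℝ → ℝ} (hψc : Continuous ψ)
    (hψ01 : ∀ ξ : ℝ, ψ ξ ∈ Set.Icc (0 : ℝ) 1) (hψ1 : ∀ ξ : ℝ, |ξ| ≤ 1 / 4 → ψ ξ = 1)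
    (hψ0 : ∀ ξ : ℝ, 1 / 2 ≤ |ξ| → ψ ξ = 0) {N a : ℝ} (hN : 2 ≤ N) (ha1 : 4 / 3 * N < a)
    (ha2 : a < 3 / 2 * N) {ξ : ℝ} (hξ : ξ ∈ Set.Icc (a - 1 / 8) (a + 1 / 8)) :
    N ^ 2 / 4 ≤ ∫ η, convIntegrand ψ a ξ η := by
  calc N ^ 2 / 4 = ∫ η, (Set.Icc (a - 1 / 8) (a + 1 / 8)).indicator (fun _ => N ^ 2) η := by
        rw [integral_indicator_const _ measurableSet_Icc, smul_eq_mul,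
          Real.volume_real_Icc_of_le (by linarith)]
        ring
    _ ≤ _ := by
        refine integral_mono ?_ (integrable_convIntegrand hψc hψ01 hψ0 hN ha1 ha2 ξ) fun η => ?_
        · rw [integrable_indicator_iff measurableSet_Icc]
          exact integrableOn_const isCompact_Icc.measure_ne_top
        · exact Set.indicator_le'
            (fun η hη => le_convIntegrand hψ1 hψ0 hN ha1 hξ hη)
            (fun η _ => convIntegrand_nonneg hψ01 hψ0 (by linarith) ξ η) η

/-- Two-sided bounds for the squared `H^σ` norm, in terms of the scaling factor `k`. -/
lemma bounds_integral_weight_mul_sq {ψ : ℝ → ℝ} (hψc : Continuous ψ)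
    (hψ01 : ∀ ξ : ℝ, ψ ξ ∈ Set.Icc (0 : ℝ) 1) (hψ1 : ∀ ξ : ℝ, |ξ| ≤ 1 / 4 → ψ ξ = 1)
    (hψ0 : ∀ ξ : ℝ, 1 / 2 ≤ |ξ| → ψ ξ = 0) {N a : ℝ} (hN : 2 ≤ N) (ha1 : 4 / 3 * N < a)
    (ha2 : a < 3 / 2 * N) {σ : ℝ} (hσ : 0 ≤ σ) (k : ℝ) :
    ∫ ξ : ℝ, (1 + ξ ^ 2) ^ σ * (k * ∫ η, convIntegrand ψ a ξ η) ^ 2 ∈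
      Set.Icc ((N ^ 2) ^ σ * (k * (N ^ 2 / 4)) ^ 2 / 4)
        (4 * ((5 * N ^ 2) ^ σ * (k * (10 * N ^ 2)) ^ 2)) := by
  set S : Set ℝ := Set.Icc (a - 1) (a + 1) ∪ Set.Icc (-a - 1) (-a + 1) with hS
  have hSm : MeasurableSet S := measurableSet_Icc.union measurableSet_Icc
  have hv : volume.real S ≤ 4 := by
    refine (measureReal_union_le _ _).trans ?_
    rw [Real.volume_real_Icc_of_le (by linarith), Real.volume_real_Icc_of_le (by linarith)]
    linarith
  have hnn : ∀ ξ, 0 ≤ ∫ η, convIntegrand ψ a ξ η := fun ξ =>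
    integral_nonneg fun η => convIntegrand_nonneg hψ01 hψ0 (by linarith) ξ η
  have hF0 : ∀ ξ : ℝ, 0 ≤ (1 + ξ ^ 2) ^ σ * (k * ∫ η, convIntegrand ψ a ξ η) ^ 2 := fun ξ => by
    positivity
  have hle : ∀ ξ : ℝ, (1 + ξ ^ 2) ^ σ * (k * ∫ η, convIntegrand ψ a ξ η) ^ 2 ≤
      S.indicator (fun _ => (5 * N ^ 2) ^ σ * (k * (10 * N ^ 2)) ^ 2) ξ := by
    intro ξ
    by_cases h : ξ ∈ S
    · rw [Set.indicator_of_mem h]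
      have hξ : ξ ^ 2 ≤ (2 * N) ^ 2 := by
        rcases h with ⟨h1, h2⟩ | ⟨h1, h2⟩ <;> refine sq_le_sq' ?_ ?_ <;> linarith
      rw [mul_pow, mul_pow]
      have := hnn ξ
      gcongr
      · nlinarith
      · exact integral_convIntegrand_le hψc hψ01 hψ0 hN ha1 ha2 ξ
    · rw [Set.indicator_of_notMem h]
      simp only [hS, Set.mem_union, Set.mem_Icc, not_or] at h
      have h1 : 1 ≤ |ξ - a| := by
        by_contra! h'
        rw [abs_lt] at h'
        exact h.1 ⟨by linarith, by linarith⟩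
      have h2 : 1 ≤ |ξ + a| := by
        by_contra! h'
        rw [abs_lt] at h'
        exact h.2 ⟨by linarith, by linarith⟩
      simp [convIntegrand_eq_zero hψ0 h1 h2]
  have hSi : Integrable (S.indicator
      (fun _ => (5 * N ^ 2) ^ σ * (k * (10 * N ^ 2)) ^ 2) : ℝ → ℝ) := by
    rw [integrable_indicator_iff hSm]
    exact integrableOn_const (measure_Icc_union_ne_top _ _ _ _)
  have hFi : Integrable fun ξ : ℝ =>
      (1 + ξ ^ 2) ^ σ * (k * ∫ η, convIntegrand ψ a ξ η) ^ 2 := by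
    refine hSi.mono' ?_ (Eventually.of_forall fun ξ => ?_)
    · have hm : StronglyMeasurable fun ξ => ∫ η, convIntegrand ψ a ξ η :=
        (continuous_convIntegrand hψc a).stronglyMeasurable.integral_prod_right
      have hw : Continuous fun ξ : ℝ => (1 + ξ ^ 2) ^ σ :=
        Continuous.rpow_const (by fun_prop) fun _ => Or.inr hσ
      exact (hw.stronglyMeasurable.mul ((hm.const_mul k).pow 2)).aestronglyMeasurable
    · rw [Real.norm_of_nonneg (hF0 ξ)]
      exact hle ξ
  constructor
  · calc _ = ∫ ξ, (Set.Icc (a - 1 / 8) (a + 1 / 8)).indicator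
          (fun _ => (N ^ 2) ^ σ * (k * (N ^ 2 / 4)) ^ 2) ξ := by
          rw [integral_indicator_const _ measurableSet_Icc, smul_eq_mul,
            Real.volume_real_Icc_of_le (by linarith)]
          ring
      _ ≤ _ := by
          refine integral_mono ?_ hFi fun ξ => ?_
          · rw [integrable_indicator_iff measurableSet_Icc]
            exact integrableOn_const isCompact_Icc.measure_ne_top
          · refine Set.indicator_le' (fun ξ hξ => ?_) (fun ξ _ => hF0 ξ) ξ
            have := le_integral_convIntegrand hψc hψ01 hψ1 hψ0 hN ha1 ha2 hξ
            have h1 := hξ.1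
            simp only [mul_pow k]
            gcongr
            nlinarith
  · calc _ ≤ _ := integral_mono hFi hSi hle
      _ ≤ _ := by
          rw [integral_indicator_const _ hSm, smul_eq_mul]
          gcongr

/-- `liminf_{n→∞} ‖f_n ∂ₓΛu_{0,n}‖_{H^{s-1}} ≥ C̃₂ > 0`. -/
theorem stmt7 (s lam : ℝ) (hs : 3 / 2 < s) (hlam : lam ∈ Set.Ioo (4 / 3 : ℝ) (3 / 2))
    (φ : SchwartzMap ℝ ℂ) (hφ : PhiHyp ⇑φ) :
    ∃ C2 > (0 : ℝ),
      C2 ≤ Filter.liminf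
        (fun n : ℕ => HNorm (s - 1) (fun x => fseq ⇑φ n x * deriv (Lam (u0n s lam ⇑φ n)) x))
        Filter.atTop := by
  obtain ⟨ψ, hFT, hψs, -, hψ01, hψ1, hψ0⟩ := hφ
  have hψc : Continuous ψ := hψs.continuous
  have hpi := Real.pi_pos
  have key : ∀ n : ℕ, 1 ≤ n →
      HNorm (s - 1) (fun x => fseq ⇑φ n x * deriv (Lam (u0n s lam ⇑φ n)) x) ∈
        Set.Icc (Real.sqrt (1 / (4 * Real.pi) ^ 2 / 64))
          (Real.sqrt (400 * 5 ^ (s - 1) / (4 * Real.pi) ^ 2)) := by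
    intro n hn
    have hN : (2 : ℝ) ≤ 2 ^ n := le_self_pow₀ (by norm_num) (by omega)
    set k : ℝ := (2 : ℝ) ^ (-(n : ℝ)) * (2 : ℝ) ^ (-((n : ℝ) * s)) / (4 * Real.pi) with hk
    have hb := bounds_integral_weight_mul_sq hψc hψ01 hψ1 hψ0 hN (a := lam * 2 ^ n)
      (by nlinarith [hlam.1]) (by nlinarith [hlam.2]) (σ := s - 1) (by linarith) k
    have hscale : (((2 : ℝ) ^ n) ^ 2) ^ (s - 1) * k ^ 2 * ((2 : ℝ) ^ n) ^ 4
        = 1 / (4 * Real.pi) ^ 2 := by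
      have e1 : (((2 : ℝ) ^ n) ^ 2) ^ (s - 1) = (2 : ℝ) ^ ((n : ℝ) * 2 * (s - 1)) := by
        rw [← Real.rpow_natCast, ← Real.rpow_natCast, ← Real.rpow_mul (by norm_num),
          ← Real.rpow_mul (by norm_num)]
        norm_num [mul_assoc]
      have e2 : ((2 : ℝ) ^ n) ^ 4 = (2 : ℝ) ^ ((n : ℝ) * 4) := by
        rw [← Real.rpow_natCast, ← Real.rpow_natCast, ← Real.rpow_mul (by norm_num)]
        norm_num
      have e3 : k ^ 2 = (2 : ℝ) ^ ((-(n : ℝ) + -((n : ℝ) * s)) * 2) / (4 * Real.pi) ^ 2 := by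
        rw [hk, div_pow, ← Real.rpow_add (by norm_num), Real.rpow_mul (by norm_num)]
        norm_num
      rw [e1, e2, e3, mul_div_assoc', div_mul_eq_mul_div, ← Real.rpow_add (by norm_num),
        ← Real.rpow_add (by norm_num)]
      rw [show (n : ℝ) * 2 * (s - 1) + (-(n : ℝ) + -((n : ℝ) * s)) * 2 + (n : ℝ) * 4 = 0 by ring,
        Real.rpow_zero]
    have hH : HNorm (s - 1) (fun x => fseq ⇑φ n x * deriv (Lam (u0n s lam ⇑φ n)) x) =
        Real.sqrt (∫ ξ : ℝ, (1 + ξ ^ 2) ^ (s - 1) *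
          (k * ∫ η, convIntegrand ψ (lam * 2 ^ n) ξ η) ^ 2) := by
      unfold HNorm
      congr 2
      ext ξ
      rw [FT_fseq_mul_deriv_Lam s lam φ φ.integrable ψ hFT hψc hψ0 n ξ, Complex.norm_real,
        Real.norm_eq_abs, sq_abs]
    rw [hH]
    refine ⟨Real.sqrt_le_sqrt ?_, Real.sqrt_le_sqrt ?_⟩
    · refine le_trans (le_of_eq ?_) hb.1
      rw [← hscale]
      ring
    · refine hb.2.trans (le_of_eq ?_)
      rw [Real.mul_rpow (by norm_num) (by positivity), mul_div_assoc,
        div_eq_mul_one_div _ ((4 * Real.pi) ^ 2), ← hscale]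
      ring
  refine ⟨Real.sqrt (1 / (4 * Real.pi) ^ 2 / 64), by positivity, ?_⟩
  refine le_liminf_of_le ?_ ?_
  · refine IsBoundedUnder.isCoboundedUnder_ge
      ⟨Real.sqrt (400 * 5 ^ (s - 1) / (4 * Real.pi) ^ 2), ?_⟩
    rw [eventually_map]
    exact (eventually_ge_atTop 1).mono fun n hn => (key n hn).2
  · exact (eventually_ge_atTop 1).mono fun n hn => (key n hn).1
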